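/- arXiv:1411.3995 — 4 statements merged into one kernel-verified Lean document; each statement's English description precedes it below -/
import Mathlib

section
/- (Kraft's inequality for martingales) For any martingale d, any binary string σ, and any finite set H of pairwise incompatible binary strings each of which extends σ, one has Σ_{τ∈H} d(τ)·2^{−|τ|} ≤ d(σ)·2^{−|σ|}. -/
namespace BP



/-- The finite binary string `(X 0, …, X (n−1))`. -/
def take (X : ℕ → Bool) (n : ℕ) : List Bool := (List.range n).map X

/-- `X ∈ [G]`: the real `X` extends some string of the finite set (list) `G`. -/
def Mem (X : ℕ → Bool) (G : List (List Bool)) : Prop :=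
  ∃ τ ∈ G, take X τ.length = τ

/-- The maximum length of a string in `G`. -/
def maxLen (G : List (List Bool)) : ℕ := (G.map List.length).foldr max 0

/-- The list of all binary strings of length `L`. -/
def allStrings (L : ℕ) : List (List Bool) :=
  (List.range (2 ^ L)).map fun k => (List.range L).map fun i => k.testBit i

/-- The uniform (fair-coin) measure of the clopen set `[G]`, computed by counting
which strings of length `maxLen G` extend a member of `G`. -/
def mu (G : List (List Bool)) : ℚ :=
  (((allStrings (maxLen G)).filter fun σ => G.any fun τ => decide (τ <+: σ)).length : ℚ)
    / 2 ^ maxLen G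

/-- The uniform measure of `[G] ∩ [τ]`. -/
def muCap (G : List (List Bool)) (τ : List Bool) : ℚ :=
  (((allStrings (max (maxLen G) τ.length)).filter fun σ =>
      decide (τ <+: σ) && (G.any fun ρ => decide (ρ <+: σ))).length : ℚ)
    / 2 ^ max (maxLen G) τ.length

/-- A primitive recursive test: a primitive recursive sequence of finite sets of
binary strings with `μ([Gₙ]) ≤ 2⁻ⁿ`. -/
def IsTest (G : ℕ → List (List Bool)) : Prop :=
  Primrec G ∧ ∀ n, mu (G n) ≤ ((2 : ℚ) ^ n)⁻¹

/-- `X` is Martin-Löf BP random. -/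
def MLBPRandom (X : ℕ → Bool) : Prop :=
  ∀ G : ℕ → List (List Bool), IsTest G → ∃ n, ¬ Mem X (G n)

/-- A weak primitive recursive test. -/
def IsWeakTest (G : ℕ → List (List Bool)) : Prop :=
  IsTest G ∧ ∃ ℓ : ℕ → ℕ, Primrec ℓ ∧ (∀ n, ∀ τ ∈ G n, τ.length = ℓ n) ∧
    ∀ n, ∀ τ ∈ G n, muCap (G (n + 1)) τ ≤ (1 / 2) * ((2 : ℚ) ^ τ.length)⁻¹

/-- A martingale with values in the nonnegative rationals. -/
def IsMartingale (d : List Bool → ℚ) : Prop :=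
  d [] = 1 ∧ (∀ σ, 0 ≤ d σ) ∧
    ∀ σ, d σ = (d (σ ++ [false]) + d (σ ++ [true])) / 2

/-- The martingale `d` succeeds primitive recursively on `X`. -/
def SucceedsPR (d : List Bool → ℚ) (X : ℕ → Bool) : Prop :=
  ∃ f : ℕ → ℕ, Primrec f ∧ ∀ n, (2 : ℚ) ^ n ≤ d (take X (f n))

/-- `X` is martingale BP random. -/
def MartingaleBPRandom (X : ℕ → Bool) : Prop :=
  ¬ ∃ d : List Bool → ℚ, Primrec d ∧ IsMartingale d ∧ SucceedsPR d X

/-- `X` is primitive recursively compressed by the machine `M`. -/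
def CompressedBy (M : List Bool → List Bool) (X : ℕ → Bool) : Prop :=
  ∃ f : ℕ → ℕ, Primrec f ∧
    ∀ c, ∃ σ : List Bool, σ.length ≤ f c - c ∧ M σ = take X (f c)

/-- `X` is Kolmogorov BP random. -/
def KolmogorovBPRandom (X : ℕ → Bool) : Prop :=
  ¬ ∃ M : List Bool → List Bool, Primrec M ∧ CompressedBy M X

/-- `M` is a (total) process machine: it is extension preserving. -/
def IsProcessMachine (M : List Bool → List Bool) : Prop :=
  ∀ σ τ : List Bool, σ <+: τ → M σ <+: M τ

/-- `M` is a quick process BP machine. -/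
def IsQuickProcessBP (M : List Bool → List Bool) : Prop :=
  Primrec M ∧ IsProcessMachine M ∧
    ∃ h : ℕ → ℕ, Primrec h ∧ Monotone h ∧ (∀ k, ∃ n, k ≤ h n) ∧
      ∀ τ : List Bool, h τ.length ≤ (M τ).length

/-- `X` is quick process BP random. -/
def QuickProcessBPRandom (X : ℕ → Bool) : Prop :=
  ¬ ∃ M : List Bool → List Bool, IsQuickProcessBP M ∧ CompressedBy M X

/-- The number of `i < n` with `X i = true`. -/
def cardBelow (X : ℕ → Bool) (n : ℕ) : ℕ := (List.range n).countP X




theorem eq_or_append_prefix {σ τ : List Bool} (h : σ <+: τ) :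
    τ = σ ∨ σ ++ [false] <+: τ ∨ σ ++ [true] <+: τ := by
  obtain ⟨ρ, rfl⟩ := h
  rcases ρ with _ | ⟨b, ρ⟩
  · simp
  · cases b
    · exact Or.inr (Or.inl ⟨ρ, by simp⟩)
    · exact Or.inr (Or.inr ⟨ρ, by simp⟩)

theorem IsMartingale.sum_le_of_length_le {d : List Bool → ℚ} (hd : IsMartingale d) (n : ℕ)
    (σ : List Bool) (H : Finset (List Bool)) (hext : ∀ τ ∈ H, σ <+: τ)
    (hinc : ∀ τ₁ ∈ H, ∀ τ₂ ∈ H, τ₁ ≠ τ₂ → ¬ τ₁ <+: τ₂)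
    (hlen : ∀ τ ∈ H, τ.length ≤ σ.length + n) :
    ∑ τ ∈ H, d τ * ((2 : ℚ) ^ τ.length)⁻¹ ≤ d σ * ((2 : ℚ) ^ σ.length)⁻¹ := by
  induction n generalizing σ H with
  | zero =>
    have hsub : H ⊆ {σ} := fun τ hτ =>
      Finset.mem_singleton.2 ((hext τ hτ).eq_of_length_le (hlen τ hτ)).symm
    calc ∑ τ ∈ H, d τ * ((2 : ℚ) ^ τ.length)⁻¹
        ≤ ∑ τ ∈ {σ}, d τ * ((2 : ℚ) ^ τ.length)⁻¹ :=
          Finset.sum_le_sum_of_subset_of_nonneg hsub fun τ _ _ =>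
            mul_nonneg (hd.2.1 τ) (by positivity)
      _ = _ := Finset.sum_singleton _ _
  | succ n ih =>
    by_cases hσ : σ ∈ H
    · have hH : H = {σ} := by
        refine Finset.eq_singleton_iff_unique_mem.2 ⟨hσ, fun τ hτ => ?_⟩
        by_contra hne
        exact hinc σ hσ τ hτ (Ne.symm hne) (hext τ hτ)
      rw [hH, Finset.sum_singleton]
    · have key : ∀ b : Bool,
          ∑ τ ∈ H with σ ++ [b] <+: τ, d τ * ((2 : ℚ) ^ τ.length)⁻¹
            ≤ d (σ ++ [b]) * ((2 : ℚ) ^ (σ ++ [b]).length)⁻¹ := by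
        intro b
        refine ih (σ ++ [b]) _ (fun τ hτ => (Finset.mem_filter.1 hτ).2)
          (fun τ₁ h₁ τ₂ h₂ => hinc τ₁ (Finset.mem_filter.1 h₁).1 τ₂ (Finset.mem_filter.1 h₂).1)
          (fun τ hτ => ?_)
        have := hlen τ (Finset.mem_filter.1 hτ).1
        simp only [List.length_append, List.length_singleton]
        lia
      have hsub : H ⊆ H.filter (σ ++ [false] <+: ·) ∪ H.filter (σ ++ [true] <+: ·) := by
        intro τ hτ
        rcases eq_or_append_prefix (hext τ hτ) with h | h | h
        · exact absurd (h ▸ hτ) hσ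
        · exact Finset.mem_union_left _ (Finset.mem_filter.2 ⟨hτ, h⟩)
        · exact Finset.mem_union_right _ (Finset.mem_filter.2 ⟨hτ, h⟩)
      have hnonneg : ∀ τ, 0 ≤ d τ * ((2 : ℚ) ^ τ.length)⁻¹ := fun τ =>
        mul_nonneg (hd.2.1 τ) (by positivity)
      calc ∑ τ ∈ H, d τ * ((2 : ℚ) ^ τ.length)⁻¹
          ≤ ∑ τ ∈ H.filter (σ ++ [false] <+: ·) ∪ H.filter (σ ++ [true] <+: ·),
              d τ * ((2 : ℚ) ^ τ.length)⁻¹ :=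
            Finset.sum_le_sum_of_subset_of_nonneg hsub fun τ _ _ => hnonneg τ
        _ ≤ ∑ τ ∈ H with σ ++ [false] <+: τ, d τ * ((2 : ℚ) ^ τ.length)⁻¹
            + ∑ τ ∈ H with σ ++ [true] <+: τ, d τ * ((2 : ℚ) ^ τ.length)⁻¹ := by
            rw [← Finset.sum_union_inter]
            exact le_add_of_nonneg_right (Finset.sum_nonneg fun τ _ => hnonneg τ)
        _ ≤ _ := add_le_add (key false) (key true)
        _ = d σ * ((2 : ℚ) ^ σ.length)⁻¹ := by
            rw [hd.2.2 σ]
            simp only [List.length_append, List.length_singleton, pow_succ, mul_inv]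
            ring

theorem stmt12 (d : List Bool → ℚ) (hd : IsMartingale d) (σ : List Bool)
    (H : Finset (List Bool)) (hext : ∀ τ ∈ H, σ <+: τ)
    (hinc : ∀ τ₁ ∈ H, ∀ τ₂ ∈ H, τ₁ ≠ τ₂ → ¬ τ₁ <+: τ₂ ∧ ¬ τ₂ <+: τ₁) :
    ∑ τ ∈ H, d τ * ((2 : ℚ) ^ τ.length)⁻¹ ≤ d σ * ((2 : ℚ) ^ σ.length)⁻¹ := by
  exact hd.sum_le_of_length_le (H.sup List.length) σ H hext
    (fun τ₁ h₁ τ₂ h₂ hne => (hinc τ₁ h₁ τ₂ h₂ hne).1)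
    (fun τ hτ => (Finset.le_sup (f := List.length) hτ).trans (Nat.le_add_left _ _))

end BP
end

section
/- For reals X and Y, X is Martin-Löf BP random relative to Y if and only if X passes every weak primitive recursive oracle test relative to the oracle Y, i.e., for every weak primitive recursive oracle test (G_n^Z) there is some n with X ∉ [G_n^Y]. -/
namespace BP



/-- Uniform oracle primitive recursion on ℕ: the inductive closure of the basic
primitive recursive functions together with (the characteristic function of) the
oracle, under pairing, composition and primitive recursion, uniformly in the
oracle `O : ℕ → Bool`. -/
inductive PrimrecIn : ((ℕ → Bool) → ℕ → ℕ) → Prop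
  | zero : PrimrecIn fun _ _ => 0
  | succ : PrimrecIn fun _ n => n + 1
  | left : PrimrecIn fun _ n => n.unpair.1
  | right : PrimrecIn fun _ n => n.unpair.2
  | oracle : PrimrecIn fun O n => cond (O n) 1 0
  | pair {f g} : PrimrecIn f → PrimrecIn g →
      PrimrecIn fun O n => Nat.pair (f O n) (g O n)
  | comp {f g} : PrimrecIn f → PrimrecIn g →
      PrimrecIn fun O n => f O (g O n)
  | prec {f g} : PrimrecIn f → PrimrecIn g →
      PrimrecIn fun O p =>
        p.unpair.2.rec (f O p.unpair.1) fun y IH => g O (Nat.pair p.unpair.1 (Nat.pair y IH))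

/-- A primitive recursive oracle function between `Primcodable` types:
it is given by a single uniform oracle primitive recursive derivation. -/
def OraclePrimrec {α β : Type} [Primcodable α] [Primcodable β]
    (f : (ℕ → Bool) → α → β) : Prop :=
  ∃ F : (ℕ → Bool) → ℕ → ℕ, PrimrecIn F ∧
    ∀ (O : ℕ → Bool) (n : ℕ),
      F O n = Encodable.encode ((Encodable.decode (α := α) n).map (f O))



/-- A primitive recursive oracle test: a primitive recursive oracle function
`Z ↦ (Gₙ^Z)` together with a primitive recursive length bound `f`, such that for
every oracle `Z`, `Gₙ^Z` consists of strings of length at most `f n` and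
`μ([Gₙ^Z]) ≤ 2⁻ⁿ`. -/
def IsOracleTest (G : (ℕ → Bool) → ℕ → List (List Bool)) (f : ℕ → ℕ) : Prop :=
  OraclePrimrec G ∧ Primrec f ∧
    (∀ (Z : ℕ → Bool) (n : ℕ), ∀ τ ∈ G Z n, τ.length ≤ f n) ∧
    ∀ (Z : ℕ → Bool) (n : ℕ), mu (G Z n) ≤ ((2 : ℚ) ^ n)⁻¹

/-- `X` is Martin-Löf BP random relative to the oracle `Y`. -/
def MLBPRandomRel (X Y : ℕ → Bool) : Prop :=
  ∀ (G : (ℕ → Bool) → ℕ → List (List Bool)) (f : ℕ → ℕ),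
    IsOracleTest G f → ∃ n, ¬ Mem X (G Y n)

/-- A weak primitive recursive oracle test. -/
def IsWeakOracleTest (G : (ℕ → Bool) → ℕ → List (List Bool)) (f : ℕ → ℕ) : Prop :=
  IsOracleTest G f ∧
    ∀ (Z : ℕ → Bool) (n : ℕ), ∀ τ ∈ G Z n,
      muCap (G Z (n + 1)) τ ≤ (1 / 2) * ((2 : ℚ) ^ τ.length)⁻¹


theorem length_le_maxLen {G : List (List Bool)} {τ : List Bool} (h : τ ∈ G) :
    τ.length ≤ maxLen G := by
  induction G with
  | nil => simp at h
  | cons a G ih =>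
    have hcons : maxLen (a :: G) = max a.length (maxLen G) := rfl
    rw [hcons]
    rcases List.mem_cons.1 h with rfl | h
    · exact le_max_left _ _
    · exact (ih h).trans (le_max_right _ _)

theorem length_of_mem_allStrings {L : ℕ} {σ : List Bool} (h : σ ∈ allStrings L) :
    σ.length = L := by
  obtain ⟨k, -, rfl⟩ := List.mem_map.1 h
  simp

theorem allStrings_succ (L : ℕ) :
    allStrings (L + 1) =
      (allStrings L).map (· ++ [false]) ++ (allStrings L).map (· ++ [true]) := by
  unfold allStrings
  rw [pow_succ, mul_two, List.range_add (n := 2 ^ L), List.map_append, List.map_map, List.map_map,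
    List.map_map]
  congr 1
  · refine List.map_congr_left fun k hk => ?_
    have hk : k < 2 ^ L := List.mem_range.1 hk
    simp [List.range_succ, Nat.testBit_lt_two_pow hk]
  · refine List.map_congr_left fun k hk => ?_
    have hk : k < 2 ^ L := List.mem_range.1 hk
    simp only [Function.comp_apply, List.range_succ, List.map_append, List.map_cons,
      List.map_nil, Nat.testBit_two_pow_add_eq, Nat.testBit_lt_two_pow hk, Bool.not_false]
    congr 1
    refine List.map_congr_left fun i hi => ?_
    exact Nat.testBit_two_pow_add_gt (List.mem_range.1 hi) k

theorem any_prefix_append (G : List (List Bool)) {σ : List Bool} (h : maxLen G ≤ σ.length)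
    (b : Bool) :
    (G.any fun τ => decide (τ <+: σ ++ [b])) = G.any fun τ => decide (τ <+: σ) := by
  refine Bool.eq_iff_iff.2 ?_
  simp only [List.any_eq_true, decide_eq_true_eq]
  refine exists_congr fun τ => and_congr_right fun hτ => ?_
  refine ⟨fun hp => ?_, fun hp => hp.trans (List.prefix_append _ _)⟩
  exact List.prefix_of_prefix_length_le hp (List.prefix_append _ _)
    ((length_le_maxLen hτ).trans h)

theorem count_succ (G : List (List Bool)) {L : ℕ} (h : maxLen G ≤ L) :
    (allStrings (L + 1)).countP (fun σ => G.any fun τ => decide (τ <+: σ)) =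
      2 * (allStrings L).countP (fun σ => G.any fun τ => decide (τ <+: σ)) := by
  have key (b : Bool) : (allStrings L).countP
        ((fun σ => G.any fun τ => decide (τ <+: σ)) ∘ (· ++ [b])) =
      (allStrings L).countP (fun σ => G.any fun τ => decide (τ <+: σ)) := by
    refine List.countP_congr fun σ hσ => ?_
    rw [Function.comp_apply,
      any_prefix_append G (h.trans (length_of_mem_allStrings hσ).ge) b]
  rw [allStrings_succ, List.countP_append, List.countP_map, List.countP_map, key, key, two_mul]

theorem mu_eq_count_div (G : List (List Bool)) {L : ℕ} (h : maxLen G ≤ L) :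
    mu G = ((allStrings L).countP (fun σ => G.any fun τ => decide (τ <+: σ)) : ℚ) / 2 ^ L := by
  induction L, h using Nat.le_induction with
  | base => rw [mu, List.countP_eq_length_filter]
  | succ L h ih =>
    rw [ih, count_succ G h, pow_succ]
    push_cast
    field_simp

theorem muCap_le_mu (G : List (List Bool)) (τ : List Bool) : muCap G τ ≤ mu G := by
  rw [mu_eq_count_div G (le_max_left (maxLen G) τ.length), muCap,
    ← List.countP_eq_length_filter]
  gcongr
  refine List.countP_mono_left fun σ _ hσ => ?_
  exact (Bool.and_eq_true_iff.1 hσ).2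

theorem PrimrecIn.of_primrec {f : ℕ → ℕ} (hf : Nat.Primrec f) : PrimrecIn fun _ => f := by
  induction hf with
  | zero => exact .zero
  | succ => exact .succ
  | left => exact .left
  | right => exact .right
  | pair _ _ hf hg => exact .pair hf hg
  | comp _ _ hf hg => exact .comp hf hg
  | prec _ _ hf hg => exact .prec hf hg

theorem OraclePrimrec.comp_primrec {β : Type} [Primcodable β] {G : (ℕ → Bool) → ℕ → β}
    (hG : OraclePrimrec G) {k : ℕ → ℕ} (hk : Primrec k) :
    OraclePrimrec fun Z n => G Z (k n) := by
  obtain ⟨F, hF, hFG⟩ := hG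
  refine ⟨_, hF.comp (PrimrecIn.of_primrec (Primrec.nat_iff.1 hk)), fun O n => ?_⟩
  simp [hFG]

/-- Indices growing fast enough that the test component at each index has measure at most
half that of any string in the component at the previous index. -/
def sparseIndex (f : ℕ → ℕ) (n : ℕ) : ℕ :=
  n.rec 0 fun _ k => f k + k + 1

theorem sparseIndex_succ (f : ℕ → ℕ) (n : ℕ) :
    sparseIndex f (n + 1) = f (sparseIndex f n) + sparseIndex f n + 1 := rfl

theorem le_sparseIndex (f : ℕ → ℕ) (n : ℕ) : n ≤ sparseIndex f n := by
  induction n with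
  | zero => exact Nat.zero_le _
  | succ n ih => rw [sparseIndex_succ]; omega

theorem primrec_sparseIndex {f : ℕ → ℕ} (hf : Primrec f) : Primrec (sparseIndex f) :=
  Primrec.nat_rec₁ 0 <| Primrec₂.comp₂ Primrec.nat_add
    (Primrec₂.comp₂ Primrec.nat_add (hf.comp Primrec.snd).to₂ Primrec₂.right)
    (Primrec₂.const 1)

theorem IsOracleTest.isWeakOracleTest_sparse {G : (ℕ → Bool) → ℕ → List (List Bool)}
    {f : ℕ → ℕ} (h : IsOracleTest G f) :
    IsWeakOracleTest (fun Z n => G Z (sparseIndex f n)) fun n => f (sparseIndex f n) := by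
  obtain ⟨hG, hf, hlen, hmu⟩ := h
  have hk := primrec_sparseIndex hf
  refine ⟨⟨hG.comp_primrec hk, hf.comp hk, fun Z n => hlen Z _, fun Z n => ?_⟩,
    fun Z n τ hτ => ?_⟩
  · refine (hmu Z _).trans ?_
    gcongr
    · norm_num
    · exact le_sparseIndex f n
  · refine (muCap_le_mu _ τ).trans ((hmu Z _).trans ?_)
    have hτ : τ.length + 1 ≤ sparseIndex f (n + 1) := by
      have := hlen Z _ τ hτ
      rw [sparseIndex_succ]
      omega
    calc ((2 : ℚ) ^ sparseIndex f (n + 1))⁻¹ ≤ (2 ^ (τ.length + 1))⁻¹ := by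
          gcongr
          norm_num
      _ = 1 / 2 * (2 ^ τ.length)⁻¹ := by rw [pow_succ, mul_inv]; ring

theorem stmt13 (X Y : ℕ → Bool) :
    MLBPRandomRel X Y ↔
      ∀ (G : (ℕ → Bool) → ℕ → List (List Bool)) (f : ℕ → ℕ),
        IsWeakOracleTest G f → ∃ n, ¬ Mem X (G Y n) := by
  refine ⟨fun h G f hG => h G f hG.1, fun h G f hG => ?_⟩
  obtain ⟨n, hn⟩ := h _ _ hG.isWeakOracleTest_sparse
  exact ⟨_, hn⟩

end BP
end

section
/- There exist reals A and B such that A is Martin-Löf BP random relative to B and B is Martin-Löf BP random relative to A, but A⊕B is not Martin-Löf BP random. -/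
namespace BP



/-- The join `A ⊕ B` of two reals: `(A⊕B)(2n) = A(n)` and `(A⊕B)(2n+1) = B(n)`. -/
def join (A B : ℕ → Bool) : ℕ → Bool := fun n => if n % 2 = 0 then A (n / 2) else B (n / 2)


/-- `A` and `A'` agree on the first `l` bits. -/
def AgreeBelow (l : ℕ) (A A' : ℕ → Bool) : Prop := ∀ i < l, A' i = A i

theorem AgreeBelow.mono {l l' : ℕ} {A A' : ℕ → Bool} (h : AgreeBelow l' A A') (hl : l ≤ l') :
    AgreeBelow l A A' := fun i hi => h i (hi.trans_le hl)

theorem AgreeBelow.trans {l : ℕ} {A A' A'' : ℕ → Bool} (h : AgreeBelow l A A')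
    (h' : AgreeBelow l A' A'') : AgreeBelow l A A'' := fun i hi => (h' i hi).trans (h i hi)

theorem take_congr {A A' : ℕ → Bool} {L : ℕ} (h : AgreeBelow L A A') : take A' L = take A L :=
  List.map_congr_left fun i hi => h i (List.mem_range.1 hi)

theorem length_take (X : ℕ → Bool) (L : ℕ) : (take X L).length = L := by simp [take]

theorem take_prefix_take (X : ℕ → Bool) {m n : ℕ} (h : m ≤ n) : take X m <+: take X n := by
  rw [List.prefix_iff_eq_take, length_take]
  simp [take, ← List.map_take, List.take_range, min_eq_left h]

theorem apply_eq_of_take_eq {X Y : ℕ → Bool} {L : ℕ} (h : take X L = take Y L) {i : ℕ}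
    (hi : i < L) : X i = Y i := by
  simpa [take, hi] using congrArg (fun l : List Bool => l[i]?) h

theorem take_mem_allStrings (X : ℕ → Bool) (L : ℕ) : take X L ∈ allStrings L := by
  refine List.mem_map.2 ⟨Nat.ofBits fun i : Fin L => X i,
    List.mem_range.2 (Nat.ofBits_lt_two_pow _), List.map_congr_left fun i hi => ?_⟩
  rw [Nat.testBit_ofBits_lt _ _ (List.mem_range.1 hi)]

theorem eq_of_testBit_eq_of_lt {L a b : ℕ} (ha : a < 2 ^ L) (hb : b < 2 ^ L)
    (h : ∀ i < L, a.testBit i = b.testBit i) : a = b := by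
  refine Nat.eq_of_testBit_eq fun i => ?_
  rcases lt_or_ge i L with hi | hi
  · exact h i hi
  · have hp : 2 ^ L ≤ 2 ^ i := Nat.pow_le_pow_right two_pos hi
    rw [Nat.testBit_lt_two_pow (ha.trans_le hp), Nat.testBit_lt_two_pow (hb.trans_le hp)]

theorem nodup_allStrings (L : ℕ) : (allStrings L).Nodup := by
  refine List.Nodup.map_on (fun a ha b hb hab => ?_) List.nodup_range
  exact eq_of_testBit_eq_of_lt (List.mem_range.1 ha) (List.mem_range.1 hb) fun i hi =>
    apply_eq_of_take_eq (X := a.testBit) (Y := b.testBit) hab hi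

theorem Mem.congr {G : List (List Bool)} {A A' : ℕ → Bool} (h : AgreeBelow (maxLen G) A A')
    (hA : Mem A' G) : Mem A G := by
  obtain ⟨τ, hτ, he⟩ := hA
  exact ⟨τ, hτ, (take_congr (h.mono (length_le_maxLen hτ))).symm.trans he⟩

/-- A clopen set containing a cylinder of length `l` has measure at least `2⁻ˡ`. -/
theorem inv_two_pow_le_mu {G : List (List Bool)} {A : ℕ → Bool} {l : ℕ}
    (h : ∀ A', AgreeBelow l A A' → Mem A' G) : ((2 : ℚ) ^ l)⁻¹ ≤ mu G := by
  set L := maxLen G with hL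
  let Y : ℕ → ℕ → Bool := fun r i => if i < l then A i else r.testBit (i - l)
  have hnodup : ((List.range (2 ^ (L - l))).map fun r => take (Y r) L).Nodup := by
    refine List.Nodup.map_on (fun a ha b hb hab => ?_) List.nodup_range
    refine eq_of_testBit_eq_of_lt (List.mem_range.1 ha) (List.mem_range.1 hb) fun i hi => ?_
    simpa [Y] using apply_eq_of_take_eq hab (i := i + l) (by omega)
  have hle := (hnodup.subperm (l₂ := (allStrings L).filter fun σ =>
      G.any fun τ => decide (τ <+: σ)) (by
    intro σ hσ
    obtain ⟨r, -, rfl⟩ := List.mem_map.1 hσ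
    obtain ⟨τ, hτ, he⟩ := h (Y r) fun i hi => by simp [Y, hi]
    refine List.mem_filter.2 ⟨take_mem_allStrings _ _, List.any_eq_true.2 ⟨τ, hτ, ?_⟩⟩
    rw [decide_eq_true_eq, ← he]
    exact take_prefix_take _ (length_le_maxLen hτ))).length_le
  rw [List.length_map, List.length_range] at hle
  rw [mu, ← hL, le_div_iff₀ (by positivity), inv_mul_le_iff₀ (by positivity)]
  calc (2 : ℚ) ^ L ≤ 2 ^ l * 2 ^ (L - l) := by
        rw [← pow_add]
        exact pow_le_pow_right₀ (by norm_num) (by omega)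
    _ ≤ _ := mul_le_mul_of_nonneg_left (by exact_mod_cast hle) (by positivity)

theorem mu_le_of_length_eq {G : List (List Bool)} {L : ℕ} (hne : G ≠ [])
    (h : ∀ τ ∈ G, τ.length = L) : mu G ≤ (G.length : ℚ) / 2 ^ L := by
  have hL : maxLen G = L := by
    refine le_antisymm ?_ ?_
    · clear hne
      induction G with
      | nil => exact Nat.zero_le _
      | cons a G ih =>
        exact max_le (h a List.mem_cons_self).le (ih fun τ hτ => h τ (List.mem_cons_of_mem _ hτ))
    · obtain ⟨τ, hτ⟩ := List.exists_mem_of_ne_nil G hne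
      exact (h τ hτ).symm.trans_le (length_le_maxLen hτ)
  have hle := (((nodup_allStrings L).filter fun σ =>
      G.any fun τ => decide (τ <+: σ)).subperm (l₂ := G) (by
    intro σ hσ
    obtain ⟨hσ, hG⟩ := List.mem_filter.1 hσ
    obtain ⟨τ, hτ, hp⟩ := List.any_eq_true.1 hG
    obtain ⟨k, -, rfl⟩ := List.mem_map.1 hσ
    have := (of_decide_eq_true hp).eq_of_length (by simp [h τ hτ])
    exact this ▸ hτ)).length_le
  rw [mu, hL]
  gcongr

/-- Every value of a primitive recursive oracle function uses only finitely many oracle bits. -/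
theorem PrimrecIn.exists_use {F : (ℕ → Bool) → ℕ → ℕ} (hF : PrimrecIn F) (O : ℕ → Bool) :
    ∀ n, ∃ u, ∀ O', AgreeBelow u O O' → F O' n = F O n := by
  induction hF with
  | zero | succ | left | right => exact fun n => ⟨0, fun _ _ => rfl⟩
  | oracle => exact fun n => ⟨n + 1, fun O' h => by simp only [h n n.lt_succ_self]⟩
  | pair _ _ ihf ihg =>
    intro n
    obtain ⟨u, hu⟩ := ihf n
    obtain ⟨v, hv⟩ := ihg n
    refine ⟨max u v, fun O' h => ?_⟩
    simp only [hu O' (h.mono (le_max_left _ _)), hv O' (h.mono (le_max_right _ _))]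
  | @comp f g _ _ ihf ihg =>
    intro n
    obtain ⟨u, hu⟩ := ihf (g O n)
    obtain ⟨v, hv⟩ := ihg n
    refine ⟨max u v, fun O' h => ?_⟩
    simp only [hv O' (h.mono (le_max_right _ _)), hu O' (h.mono (le_max_left _ _))]
  | @prec f g _ _ ihf ihg =>
    intro n
    simp only
    induction n.unpair.2 with
    | zero => exact ihf _
    | succ y ih =>
      obtain ⟨u, hu⟩ := ih
      obtain ⟨v, hv⟩ := ihg _
      refine ⟨max u v, fun O' h => ?_⟩
      simp only [hu O' (h.mono (le_max_left _ _))]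
      exact hv O' (h.mono (le_max_right _ _))

theorem countable_primrecIn : {F | PrimrecIn F}.Countable := by
  let ev : Nat.Partrec.Code → (ℕ → Bool) → ℕ → ℕ := fun c =>
    Nat.Partrec.Code.rec (fun _ _ => 0) (fun _ n => n + 1) (fun _ n => n.unpair.1)
      (fun _ n => n.unpair.2) (fun _ _ f g O n => Nat.pair (f O n) (g O n))
      (fun _ _ f g O n => f O (g O n))
      (fun _ _ f g O p =>
        p.unpair.2.rec (f O p.unpair.1) fun y IH => g O (Nat.pair p.unpair.1 (Nat.pair y IH)))
      (fun _ _ O n => cond (O n) 1 0) c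
  refine (Set.countable_range ev).mono fun F hF => ?_
  induction hF with
  | zero => exact ⟨.zero, rfl⟩
  | succ => exact ⟨.succ, rfl⟩
  | left => exact ⟨.left, rfl⟩
  | right => exact ⟨.right, rfl⟩
  | oracle => exact ⟨.rfind' .zero, rfl⟩
  | pair _ _ ihf ihg =>
    obtain ⟨⟨c, rfl⟩, ⟨d, rfl⟩⟩ := And.intro ihf ihg
    exact ⟨.pair c d, rfl⟩
  | comp _ _ ihf ihg =>
    obtain ⟨⟨c, rfl⟩, ⟨d, rfl⟩⟩ := And.intro ihf ihg
    exact ⟨.comp c d, rfl⟩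
  | prec _ _ ihf ihg =>
    obtain ⟨⟨c, rfl⟩, ⟨d, rfl⟩⟩ := And.intro ihf ihg
    exact ⟨.prec c d, rfl⟩

/-- The oracle sequences that underlie an oracle test for some length bound. -/
def oracleTests : Set ((ℕ → Bool) → ℕ → List (List Bool)) :=
  {G | OraclePrimrec G ∧ ∀ Z n, mu (G Z n) ≤ ((2 : ℚ) ^ n)⁻¹}

theorem countable_oracleTests : oracleTests.Countable := by
  choose F hF hFG using fun G : oracleTests => G.2.1
  have := countable_primrecIn.to_subtype
  refine Set.countable_coe_iff.1 (Function.Injective.countable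
    (f := fun G : oracleTests => (⟨F G, hF G⟩ : {F | PrimrecIn F})) fun G H h => ?_)
  have h' : F G = F H := congrArg Subtype.val h
  refine Subtype.ext (funext fun O => funext fun n => ?_)
  have := (hFG G O n).symm.trans ((congrFun (congrFun h' O) n).trans (hFG H O n))
  simpa using this

theorem OraclePrimrec.exists_use {G : (ℕ → Bool) → ℕ → List (List Bool)} (hG : OraclePrimrec G)
    (O : ℕ → Bool) (n : ℕ) : ∃ u, ∀ O', AgreeBelow u O O' → G O' n = G O n := by
  obtain ⟨F, hF, hFG⟩ := hG
  obtain ⟨u, hu⟩ := hF.exists_use O n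
  refine ⟨u, fun O₁ hO₁ => ?_⟩
  simpa [hFG] using hu O₁ hO₁

/-- On each interval `[k, 2k)` one of the two reals vanishes. -/
def AlternatelyZero (A B : ℕ → Bool) : Prop :=
  ∀ k, (∀ i, k ≤ i → i < 2 * k → A i = false) ∨ (∀ i, k ≤ i → i < 2 * k → B i = false)

/-- A pair of alternately vanishing reals, both of them zero from position `l` on. -/
structure FinitePair (A B : ℕ → Bool) (l : ℕ) : Prop where
  left_zero : ∀ i, l ≤ i → A i = false
  right_zero : ∀ i, l ≤ i → B i = false
  alternate : AlternatelyZero A B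

theorem FinitePair.symm {A B : ℕ → Bool} {l : ℕ} (h : FinitePair A B l) : FinitePair B A l :=
  ⟨h.right_zero, h.left_zero, fun k => (h.alternate k).symm⟩

/-- The first `l` bits of `A` and `B` force the left real to pass the test `G` relative to the
right one. -/
def Forces (G : (ℕ → Bool) → ℕ → List (List Bool)) (A B : ℕ → Bool) (l : ℕ) : Prop :=
  ∃ n, ∀ A' B', AgreeBelow l A A' → AgreeBelow l B B' → ¬ Mem A' (G B' n)

theorem Forces.mono {G : (ℕ → Bool) → ℕ → List (List Bool)} {A B A' B' : ℕ → Bool} {l l' : ℕ}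
    (h : Forces G A B l) (hl : l ≤ l') (hA : AgreeBelow l A A') (hB : AgreeBelow l B B') :
    Forces G A' B' l' := by
  obtain ⟨n, hn⟩ := h
  exact ⟨n, fun A'' B'' hA' hB' => hn _ _ (hA.trans (hA'.mono hl)) (hB.trans (hB'.mono hl))⟩

theorem FinitePair.exists_forces {A B : ℕ → Bool} {l : ℕ} (h : FinitePair A B l)
    {G : (ℕ → Bool) → ℕ → List (List Bool)} (hG : G ∈ oracleTests) :
    ∃ A' l', l < l' ∧ AgreeBelow l A A' ∧ FinitePair A' B l' ∧ Forces G A' B l' := by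
  obtain ⟨A₁, hA₁, hmem⟩ : ∃ A₁, AgreeBelow (2 * l) A A₁ ∧ ¬ Mem A₁ (G B (2 * l + 1)) := by
    by_contra! hcon
    have hlt : ((2 : ℚ) ^ (2 * l + 1))⁻¹ < ((2 : ℚ) ^ (2 * l))⁻¹ :=
      inv_strictAnti₀ (by positivity) (pow_lt_pow_right₀ (by norm_num) (Nat.lt_succ_self _))
    exact absurd ((inv_two_pow_le_mu hcon).trans (hG.2 B _)) (not_le.2 hlt)
  obtain ⟨u, hu⟩ := hG.1.exists_use B (2 * l + 1)
  let l' := max (max (maxLen (G B (2 * l + 1))) u) (2 * l + 1)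
  have hl' : 2 * l + 1 ≤ l' := le_max_right _ _
  have hlen : maxLen (G B (2 * l + 1)) ≤ l' := (le_max_left _ _).trans (le_max_left _ _)
  have hul : u ≤ l' := (le_max_right _ _).trans (le_max_left _ _)
  let A' : ℕ → Bool := fun i => if i < l' then A₁ i else false
  have hA' : AgreeBelow (2 * l) A A' := fun i hi => by
    simp only [A', if_pos (show i < l' by omega), hA₁ i hi]
  refine ⟨A', l', by omega, hA'.mono (by omega), ⟨fun i hi => ?_, fun i hi => ?_, fun k => ?_⟩,
    2 * l + 1, fun A'' B'' hA'' hB'' hM => hmem ?_⟩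
  · simp only [A', if_neg (not_lt.2 hi)]
  · exact h.right_zero i (by omega)
  · rcases le_or_gt l k with hk | hk
    · exact .inr fun i hi _ => h.right_zero i (hk.trans hi)
    · refine (h.alternate k).imp_left fun hz i hi hi' => ?_
      rw [hA' i (by omega), hz i hi hi']
  · rw [hu B'' (hB''.mono hul)] at hM
    refine (hM.congr (A := A₁)) fun i hi => ?_
    rw [hA'' i (by omega)]
    simp only [A', if_pos (show i < l' by omega)]

theorem FinitePair.exists_forces_both {A B : ℕ → Bool} {l : ℕ} (h : FinitePair A B l)
    {G : (ℕ → Bool) → ℕ → List (List Bool)} (hG : G ∈ oracleTests) :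
    ∃ A' B' l', FinitePair A' B' l' ∧ l < l' ∧ AgreeBelow l A A' ∧ AgreeBelow l B B' ∧
      Forces G A' B' l' ∧ Forces G B' A' l' := by
  obtain ⟨A', l', hl, hA, hp, hf⟩ := h.exists_forces hG
  obtain ⟨B', l'', hl', hB, hp', hf'⟩ := hp.symm.exists_forces hG
  exact ⟨A', B', l'', hp'.symm, hl.trans hl', hA, hB.mono hl.le,
    hf.mono hl'.le (fun _ _ => rfl) hB, hf'⟩

theorem exists_alternatelyZero_random :
    ∃ A B : ℕ → Bool, AlternatelyZero A B ∧ MLBPRandomRel A B ∧ MLBPRandomRel B A := by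
  obtain ⟨e, he⟩ := Set.countable_iff_exists_subset_range.1 countable_oracleTests
  let State := {p : (ℕ → Bool) × (ℕ → Bool) × ℕ // FinitePair p.1 p.2.1 p.2.2}
  have hstep : ∀ (n : ℕ) (p : State), ∃ q : State, p.1.2.2 < q.1.2.2 ∧
      AgreeBelow p.1.2.2 p.1.1 q.1.1 ∧ AgreeBelow p.1.2.2 p.1.2.1 q.1.2.1 ∧
      (e n ∈ oracleTests → Forces (e n) q.1.1 q.1.2.1 q.1.2.2 ∧
        Forces (e n) q.1.2.1 q.1.1 q.1.2.2) := by
    rintro n ⟨⟨A, B, l⟩, hp⟩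
    by_cases hG : e n ∈ oracleTests
    · obtain ⟨A', B', l', hp', hl, hA, hB, hf⟩ := hp.exists_forces_both hG
      exact ⟨⟨⟨A', B', l'⟩, hp'⟩, hl, hA, hB, fun _ => hf⟩
    · exact ⟨⟨⟨A, B, l + 1⟩, fun i hi => hp.left_zero i ((Nat.le_succ l).trans hi),
        fun i hi => hp.right_zero i ((Nat.le_succ l).trans hi), hp.alternate⟩, Nat.lt_succ_self l,
        fun _ _ => rfl, fun _ _ => rfl, fun h => absurd h hG⟩
  choose next hlt hA hB hforce using hstep
  let s : ℕ → State := fun n => Nat.rec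
    ⟨⟨fun _ => false, fun _ => false, 0⟩, fun _ _ => rfl, fun _ _ => rfl,
      fun _ => .inl fun _ _ _ => rfl⟩ next n
  have hs : ∀ n, s (n + 1) = next n (s n) := fun _ => rfl
  have hmono : StrictMono fun n => (s n).1.2.2 := strictMono_nat_of_lt_succ fun n => hlt n (s n)
  have hagree : ∀ m d, AgreeBelow (s m).1.2.2 (s m).1.1 (s (m + d)).1.1 ∧
      AgreeBelow (s m).1.2.2 (s m).1.2.1 (s (m + d)).1.2.1 := by
    intro m d
    induction d with
    | zero => exact ⟨fun _ _ => rfl, fun _ _ => rfl⟩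
    | succ d ih =>
      have hle : (s m).1.2.2 ≤ (s (m + d)).1.2.2 := hmono.monotone (Nat.le_add_right m d)
      exact ⟨ih.1.trans ((hA (m + d) (s (m + d))).mono hle),
        ih.2.trans ((hB (m + d) (s (m + d))).mono hle)⟩
  have hlim : ∀ n i, i < (s n).1.2.2 → (s (i + 1)).1.1 i = (s n).1.1 i ∧
      (s (i + 1)).1.2.1 i = (s n).1.2.1 i := by
    intro n i hi
    have hi' : i < (s (i + 1)).1.2.2 := hmono.le_apply (x := i + 1)
    have h₁ := hagree n (i + 1)
    have h₂ := hagree (i + 1) n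
    rw [add_comm (i + 1) n] at h₂
    exact ⟨(h₂.1 i hi').symm.trans (h₁.1 i hi), (h₂.2 i hi').symm.trans (h₁.2 i hi)⟩
  refine ⟨fun i => (s (i + 1)).1.1 i, fun i => (s (i + 1)).1.2.1 i, fun k => ?_,
    fun G f hG => ?_, fun G f hG => ?_⟩
  · have hk : 2 * k ≤ (s (2 * k)).1.2.2 := hmono.le_apply
    refine ((s (2 * k)).2.alternate k).imp (fun h i hi hi' => ?_) fun h i hi hi' => ?_
    · exact (hlim _ i (hi'.trans_le hk)).1.trans (h i hi hi')
    · exact (hlim _ i (hi'.trans_le hk)).2.trans (h i hi hi')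
  all_goals
    have hG' : G ∈ oracleTests := ⟨hG.1, hG.2.2.2⟩
    obtain ⟨n, rfl⟩ := he hG'
  · obtain ⟨m, hm⟩ := (hforce n (s n) hG').1
    exact ⟨m, hm _ _ (fun i hi => (hlim (n + 1) i hi).1) fun i hi => (hlim (n + 1) i hi).2⟩
  · obtain ⟨m, hm⟩ := (hforce n (s n) hG').2
    exact ⟨m, hm _ _ (fun i hi => (hlim (n + 1) i hi).2) fun i hi => (hlim (n + 1) i hi).1⟩

/-- The string of length `4m` whose bits at positions `i ≥ 2m` with `i % 2 = c` vanish, the other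
bits being given by the first `3m` binary digits of `j`. -/
def halfZeroString (m c j : ℕ) : List Bool :=
  take (fun i => if i < 2 * m then j.testBit i else
    if i % 2 = c then false else j.testBit (i / 2 + m)) (4 * m)

/-- The strings of length `4m` whose even or odd bits vanish from position `2m` on. -/
def halfZeroStrings (m : ℕ) : List (List Bool) :=
  (List.range (2 ^ (3 * m))).map (halfZeroString m 0) ++
    (List.range (2 ^ (3 * m))).map (halfZeroString m 1)

theorem primrec₂_pow : Primrec₂ ((· ^ ·) : ℕ → ℕ → ℕ) :=
  Primrec₂.unpaired'.1 Nat.Primrec.pow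

theorem primrec₂_testBit : Primrec₂ Nat.testBit := by
  have h : PrimrecPred fun p : ℕ × ℕ => p.1 / 2 ^ p.2 % 2 = 1 :=
    Primrec.eq.comp (Primrec.nat_mod.comp (Primrec.nat_div.comp Primrec.fst
      (primrec₂_pow.comp (Primrec.const 2) Primrec.snd)) (Primrec.const 2)) (Primrec.const 1)
  refine h.decide.of_eq fun p => ?_
  rw [Nat.testBit_eq_decide_div_mod_eq]

theorem primrec₂_halfZeroString (c : ℕ) : Primrec₂ fun m j => halfZeroString m c j := by
  have hm : Primrec fun q : (ℕ × ℕ) × ℕ => q.1.1 := Primrec.fst.comp Primrec.fst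
  have hj : Primrec fun q : (ℕ × ℕ) × ℕ => q.1.2 := Primrec.snd.comp Primrec.fst
  refine Primrec.list_map (Primrec.list_range.comp
    (Primrec.nat_mul.comp (Primrec.const 4) Primrec.fst)) ?_
  refine Primrec.ite (Primrec.nat_lt.comp Primrec.snd
    (Primrec.nat_mul.comp (Primrec.const 2) hm)) (primrec₂_testBit.comp hj Primrec.snd) ?_
  refine Primrec.ite (Primrec.eq.comp (Primrec.nat_mod.comp Primrec.snd (Primrec.const 2))
    (Primrec.const c)) (Primrec.const false) ?_
  exact primrec₂_testBit.comp hj (Primrec.nat_add.comp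
    (Primrec.nat_div.comp Primrec.snd (Primrec.const 2)) hm)

theorem primrec_halfZeroStrings : Primrec halfZeroStrings := by
  have hr : Primrec fun m : ℕ => List.range (2 ^ (3 * m)) :=
    Primrec.list_range.comp (primrec₂_pow.comp (Primrec.const 2)
      (Primrec.nat_mul.comp (Primrec.const 3) Primrec.id))
  exact Primrec.list_append.comp (Primrec.list_map hr (primrec₂_halfZeroString 0))
    (Primrec.list_map hr (primrec₂_halfZeroString 1))

theorem isTest_halfZeroStrings : IsTest fun n => halfZeroStrings (n + 1) := by
  refine ⟨primrec_halfZeroStrings.comp Primrec.succ, fun n => ?_⟩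
  have hlen : (halfZeroStrings (n + 1)).length = 2 * 2 ^ (3 * (n + 1)) := by
    simp [halfZeroStrings, two_mul]
  refine (mu_le_of_length_eq (L := 4 * (n + 1)) (fun h => ?_) fun τ hτ => ?_).trans ?_
  · simp [h] at hlen
  · rcases List.mem_append.1 hτ with h | h <;>
    · obtain ⟨j, -, rfl⟩ := List.mem_map.1 h
      exact length_take _ _
  · rw [hlen, show 4 * (n + 1) = n + (3 * (n + 1) + 1) by ring, div_le_iff₀ (by positivity),
      pow_add, inv_mul_cancel_left₀ (by positivity)]
    push_cast
    rw [pow_succ, mul_comm]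

theorem mem_halfZeroStrings {X : ℕ → Bool} {m c : ℕ} (hc : c < 2)
    (h : ∀ i, 2 * m ≤ i → i < 4 * m → i % 2 = c → X i = false) : Mem X (halfZeroStrings m) := by
  let j := Nat.ofBits fun i : Fin (3 * m) =>
    if (i : ℕ) < 2 * m then X i else X (2 * (i - m) + (1 - c))
  have hj : j < 2 ^ (3 * m) := Nat.ofBits_lt_two_pow _
  have htake : take X (4 * m) = halfZeroString m c j := by
    refine take_congr fun i hi => ?_
    by_cases h₁ : i < 2 * m
    · rw [if_pos h₁, Nat.testBit_ofBits_lt _ _ (by omega), if_pos h₁]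
    · rw [if_neg h₁]
      by_cases h₂ : i % 2 = c
      · rw [if_pos h₂, h i (by omega) hi h₂]
      · rw [if_neg h₂, Nat.testBit_ofBits_lt _ _ (by omega), if_neg (by simp only; omega)]
        congr 1
        simp only
        omega
  refine ⟨halfZeroString m c j, List.mem_append.2 ?_, ?_⟩
  · have hr := List.mem_range.2 hj
    interval_cases c
    · exact .inl (List.mem_map_of_mem hr)
    · exact .inr (List.mem_map_of_mem hr)
  · rw [← htake, length_take]

theorem AlternatelyZero.not_mlbpRandom_join {A B : ℕ → Bool} (h : AlternatelyZero A B) :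
    ¬ MLBPRandom (join A B) := by
  intro hr
  obtain ⟨n, hn⟩ := hr _ isTest_halfZeroStrings
  refine hn ?_
  rcases h (n + 1) with h | h
  · refine mem_halfZeroStrings (c := 0) (by norm_num) fun i hi hi' hc => ?_
    rw [join, if_pos hc, h _ (by omega) (by omega)]
  · refine mem_halfZeroStrings (c := 1) (by norm_num) fun i hi hi' hc => ?_
    rw [join, if_neg (by omega), h _ (by omega) (by omega)]

theorem stmt16 :
    ∃ A B : ℕ → Bool, MLBPRandomRel A B ∧ MLBPRandomRel B A ∧
      ¬ MLBPRandom (join A B) := by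
  obtain ⟨A, B, hz, hA, hB⟩ := exists_alternatelyZero_random
  exact ⟨A, B, hA, hB, hz.not_mlbpRandom_join⟩

end BP
end

section
/- If X is a Martin-Löf BP random real and (U_n) = ([G_n]) is any primitive recursive test, then X ∉ U_n for infinitely many n. -/
namespace BP



/-- The tail of a primitive recursive test is again a primitive recursive test. -/
theorem IsTest.tail {G : ℕ → List (List Bool)} (hG : IsTest G) (N : ℕ) :
    IsTest fun n => G (n + N) := by
  refine ⟨hG.1.comp (Primrec.nat_add.comp Primrec.id (Primrec.const N)), fun n => ?_⟩
  refine (hG.2 (n + N)).trans ?_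
  gcongr
  · norm_num
  · omega

theorem stmt19 (X : ℕ → Bool) (G : ℕ → List (List Bool))
    (hX : MLBPRandom X) (hG : IsTest G) : ∀ N, ∃ n ≥ N, ¬ Mem X (G n) := by
  intro N
  obtain ⟨n, hn⟩ := hX _ (hG.tail N)
  exact ⟨n + N, Nat.le_add_left N n, hn⟩

end BP
end
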